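/- arXiv:1801.03885 — 2 statements merged into one kernel-verified Lean document; each statement's English description precedes it below -/
import Mathlib

section
/- Let n, p ≥ 1 be integers, let α be a real number with α ∉ {0, 1}, and consider tuples of positive integers (x_1, …, x_n) with x_1 + ⋯ + x_n = p. If α < 0 or α > 1, then the function f(x_1, …, x_n) = Σ_{i=1}^n x_i^α attains its minimum over such tuples at a tuple if and only if the tuple is almost equal, i.e., |x_i − x_j| ≤ 1 for all i, j ∈ {1, …, n}. -/
theorem aux_conv (α : ℝ) (hα : α < 0 ∨ 1 < α) :
    StrictConvexOn ℝ (Set.Ioi (0:ℝ)) (fun x : ℝ => x ^ α) := by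
  rcases hα with h | h
  · refine ⟨convex_Ioi 0, ?_⟩
    intro x hx y hy hxy a b ha hb hab
    have hx0 : (0:ℝ) < x := hx
    have hy0 : (0:ℝ) < y := hy
    have hz0 : 0 < a * x + b * y := by positivity
    have h1 := strictConcaveOn_log_Ioi.2 hx hy hxy ha hb hab
    have h2 := convexOn_exp.2 (Set.mem_univ (Real.log x * α)) (Set.mem_univ (Real.log y * α))
      ha.le hb.le hab
    simp only [smul_eq_mul] at h1 h2 ⊢
    rw [Real.rpow_def_of_pos hx0, Real.rpow_def_of_pos hy0, Real.rpow_def_of_pos hz0]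
    refine lt_of_lt_of_le (Real.exp_lt_exp.mpr ?_) h2
    nlinarith
  · exact (strictConvexOn_rpow h).subset Set.Ioi_subset_Ici_self (convex_Ioi 0)

theorem aux_strict (f : ℝ → ℝ) (hf : StrictConvexOn ℝ (Set.Ioi (0:ℝ)) f) (a b : ℝ)
    (hb : 0 < b) (hab : b + 2 ≤ a) : f (a - 1) + f (b + 1) < f a + f b := by
  have hd : 0 < a - b := by linarith
  have ht : 0 < 1 / (a - b) := by positivity
  have ht1 : 0 < 1 - 1 / (a - b) := by
    rw [sub_pos, div_lt_one hd]; linarith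
  have ha : (a : ℝ) ∈ Set.Ioi (0:ℝ) := by simp only [Set.mem_Ioi]; linarith
  have hb' : (b : ℝ) ∈ Set.Ioi (0:ℝ) := hb
  have hne : a ≠ b := by intro h; linarith
  have h1 := hf.2 ha hb' hne ht ht1 (by ring)
  have h2 := hf.2 ha hb' hne ht1 ht (by ring)
  have hc : 1 / (a - b) * (a - b) = 1 := by field_simp
  simp only [smul_eq_mul] at h1 h2
  have e1 : 1 / (a - b) * a + (1 - 1 / (a - b)) * b = b + 1 := by linear_combination hc
  have e2 : (1 - 1 / (a - b)) * a + 1 / (a - b) * b = a - 1 := by linear_combination -hc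
  rw [e1] at h1
  rw [e2] at h2
  linarith

theorem aux_line (f : ℝ → ℝ) (hf : ConvexOn ℝ (Set.Ioi (0:ℝ)) f) (m k : ℕ)
    (hm : 1 ≤ m) (hk : 1 ≤ k) :
    f m + ((k:ℝ) - m) * (f (m + 1) - f m) ≤ f k := by
  have hm' : (0:ℝ) < m := by exact_mod_cast hm
  have hk' : (0:ℝ) < k := by exact_mod_cast hk
  have hm1 : (0:ℝ) < m + 1 := by linarith
  rcases lt_trichotomy k m with h | h | h
  · have h' : (k:ℝ) < m := by exact_mod_cast h
    have := hf.slope_mono_adjacent (x := (k:ℝ)) (y := m) (z := m + 1) hk' hm1 h' (by linarith)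
    rw [add_sub_cancel_left, div_one, div_le_iff₀ (by linarith)] at this
    linarith
  · subst h; simp
  · rcases Nat.eq_or_lt_of_le (Nat.succ_le_of_lt h) with h | h
    · subst h; simp
    · have h' : (m:ℝ) + 1 < k := by exact_mod_cast h
      have := hf.slope_mono_adjacent (x := (m:ℝ)) (y := m + 1) (z := k) hm' hk' (by linarith) h'
      rw [add_sub_cancel_left, div_one, le_div_iff₀ (by linarith)] at this
      linarith

theorem aux_sum {n : ℕ} (x : Fin n → ℕ) (i j : Fin n) (hij : i ≠ j) (a b : ℕ) (F : ℕ → ℝ) :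
    ∑ k, F (Function.update (Function.update x i a) j b k)
      = ∑ k, F (x k) + (F a - F (x i)) + (F b - F (x j)) := by
  have : ∀ k, F (Function.update (Function.update x i a) j b k) =
      F (x k) + (if k = i then F a - F (x i) else 0) + (if k = j then F b - F (x j) else 0) := by
    intro k
    by_cases h1 : k = j
    · subst h1; simp [hij.symm]
    · by_cases h2 : k = i
      · subst h2; simp [h1]
      · simp [h1, h2]
  simp [this, Finset.sum_add_distrib]

/-- For `α < 0` or `α > 1`, a tuple of positive integers summing to `p` minimizes
`Σ xᵢ^α` among all such tuples iff its entries are almost equal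
(`|xᵢ - xⱼ| ≤ 1` for all `i, j`). -/
theorem stmt9 (n p : ℕ) (hn : 1 ≤ n) (hp : 1 ≤ p) (α : ℝ)
    (hα0 : α ≠ 0) (hα1 : α ≠ 1) (hα : α < 0 ∨ 1 < α)
    (x : Fin n → ℕ) (hx : ∀ i, 1 ≤ x i) (hsum : ∑ i, x i = p) :
    (∀ y : Fin n → ℕ, (∀ i, 1 ≤ y i) → ∑ i, y i = p →
        (∑ i, (x i : ℝ) ^ α) ≤ ∑ i, (y i : ℝ) ^ α) ↔
      ∀ i j, |(x i : ℤ) - (x j : ℤ)| ≤ 1 := by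
  have hf := aux_conv α hα
  constructor
  · intro hmin
    have key : ∀ i j, x i ≤ x j + 1 := by
      intro i j
      by_contra hc
      have hc' : x j + 2 ≤ x i := by omega
      have hij : i ≠ j := by rintro rfl; omega
      have hpos := hx j
      have h := hmin (Function.update (Function.update x i (x i - 1)) j (x j + 1)) ?_ ?_
      · rw [aux_sum x i j hij _ _ (fun k => (k:ℝ) ^ α)] at h
        have := aux_strict _ hf (x i) (x j) (by exact_mod_cast hpos) (by exact_mod_cast hc')
        simp only [] at this h
        rw [Nat.cast_sub (hx i)] at h
        push_cast at h
        linarith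
      · intro k
        by_cases h1 : k = j
        · subst h1; simp
        · by_cases h2 : k = i
          · subst h2; simp [h1]; omega
          · simp [h1, h2, hx k]
      · have h := aux_sum x i j hij (x i - 1) (x j + 1) (fun k => (k:ℝ))
        rw [Nat.cast_sub (hx i)] at h
        have h3 : ((∑ k, x k : ℕ) : ℝ) = p := by exact_mod_cast hsum
        push_cast at h h3
        have h4 : ((∑ k, Function.update (Function.update x i (x i - 1)) j (x j + 1) k : ℕ) : ℝ)
            = p := by
          rw [Nat.cast_sum, h]; linarith
        exact_mod_cast h4
    intro i j
    have h1 := key i j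
    have h2 := key j i
    rw [abs_le]; omega
  · intro hae y hy hysum
    have : Nonempty (Fin n) := ⟨⟨0, hn⟩⟩
    obtain ⟨i0, hi0⟩ := Finite.exists_min x
    set m := x i0 with hm
    set d : ℝ := ((m:ℝ) + 1) ^ α - (m:ℝ) ^ α with hd
    have hxe : ∀ i, (x i : ℝ) ^ α = (m:ℝ) ^ α + ((x i : ℝ) - m) * d := by
      intro i
      have h1 := hi0 i
      have h2 := (abs_le.mp (hae i i0)).2
      have : x i = m ∨ x i = m + 1 := by omega
      rcases this with h | h
      · rw [h]; simp
      · rw [h]; push_cast; rw [hd]; ring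
    have hye : ∀ i, (m:ℝ) ^ α + ((y i : ℝ) - m) * d ≤ (y i : ℝ) ^ α := fun i =>
      aux_line _ hf.convexOn m (y i) (hx i0) (hy i)
    have hs : ∑ i, (x i : ℝ) = ∑ i, (y i : ℝ) := by
      exact_mod_cast hsum.trans hysum.symm
    calc ∑ i, (x i : ℝ) ^ α = ∑ i, ((m:ℝ) ^ α + ((x i : ℝ) - m) * d) :=
          Finset.sum_congr rfl fun i _ => hxe i
      _ = ∑ i, ((m:ℝ) ^ α + ((y i : ℝ) - m) * d) := by
          rw [Finset.sum_add_distrib, Finset.sum_add_distrib, ← Finset.sum_mul, ← Finset.sum_mul,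
            Finset.sum_sub_distrib, Finset.sum_sub_distrib, hs]
      _ ≤ _ := Finset.sum_le_sum fun i _ => hye i
end

section
/- Let n, p ≥ 1 be integers, let α be a real number with 0 < α < 1, and consider tuples of positive integers (x_1, …, x_n) with x_1 + ⋯ + x_n = p. Then the function f(x_1, …, x_n) = Σ_{i=1}^n x_i^α attains its maximum over such tuples at a tuple if and only if the tuple is almost equal, i.e., |x_i − x_j| ≤ 1 for all i, j ∈ {1, …, n}. -/
lemma d_anti (α : ℝ) (hα0 : 0 < α) (hα1 : α < 1) :
    StrictAnti (fun t : ℕ => ((t + 1 : ℕ) : ℝ) ^ α - (t : ℝ) ^ α) := by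
  apply strictAnti_nat_of_succ_lt
  intro t
  have h := (Real.strictConcaveOn_rpow hα0 hα1).slope_anti_adjacent
    (x := (t : ℝ)) (y := ((t + 1 : ℕ) : ℝ)) (z := ((t + 1 + 1 : ℕ) : ℝ))
    (by simp) (by simp only [Set.mem_Ici]; positivity) (by push_cast; linarith)
    (by push_cast; linarith)
  have e1 : ((t + 1 + 1 : ℕ) : ℝ) - ((t + 1 : ℕ) : ℝ) = 1 := by push_cast; ring
  have e2 : ((t + 1 : ℕ) : ℝ) - (t : ℝ) = 1 := by push_cast; ring
  rw [e1, e2, div_one, div_one] at h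
  exact h

lemma secant (g : ℕ → ℝ) (h : StrictAnti (fun t : ℕ => g (t + 1) - g t)) (m t : ℕ) :
    g t ≤ g m + ((t : ℝ) - m) * (g (m + 1) - g m) := by
  rcases le_total m t with hmt | hmt
  · induction t, hmt using Nat.le_induction with
    | base => simp
    | succ k hk ih =>
      have := h.antitone hk
      push_cast
      linarith
  · induction m, hmt using Nat.le_induction with
    | base => simp
    | succ k hk ih =>
      have := h.antitone (Nat.le_succ k)
      simp only [Nat.succ_eq_add_one] at this
      have hk' : (t : ℝ) ≤ k := by exact_mod_cast hk
      push_cast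
      nlinarith

lemma sum_swap {n : ℕ} (x : Fin n → ℕ) (i j : Fin n) (hij : i ≠ j) (h : ℕ → ℝ) :
    ∑ k, h (if k = i then x i - 1 else if k = j then x j + 1 else x k)
      = ∑ k, h (x k) + (h (x i - 1) - h (x i)) + (h (x j + 1) - h (x j)) := by
  have : ∀ k, h (if k = i then x i - 1 else if k = j then x j + 1 else x k)
      = h (x k) + (if k = i then h (x i - 1) - h (x i) else 0)
        + (if k = j then h (x j + 1) - h (x j) else 0) := by
    intro k
    by_cases h1 : k = i
    · subst h1; simp [hij]
    · by_cases h2 : k = j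
      · subst h2; simp [h1]
      · simp [h1, h2]
  simp only [this, Finset.sum_add_distrib, Finset.sum_ite_eq', Finset.mem_univ, if_true]

/-- For `0 < α < 1`, a tuple of positive integers summing to `p` maximizes
`Σ xᵢ^α` among all such tuples iff its entries are almost equal
(`|xᵢ - xⱼ| ≤ 1` for all `i, j`). -/
theorem stmt10 (n p : ℕ) (hn : 1 ≤ n) (hp : 1 ≤ p) (α : ℝ)
    (hα0 : 0 < α) (hα1 : α < 1)
    (x : Fin n → ℕ) (hx : ∀ i, 1 ≤ x i) (hsum : ∑ i, x i = p) :
    (∀ y : Fin n → ℕ, (∀ i, 1 ≤ y i) → ∑ i, y i = p →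
        (∑ i, (y i : ℝ) ^ α) ≤ ∑ i, (x i : ℝ) ^ α) ↔
      ∀ i j, |(x i : ℤ) - (x j : ℤ)| ≤ 1 := by
  have hd := d_anti α hα0 hα1
  constructor
  · intro H
    have key : ∀ i j, x i ≤ x j + 1 := by
      intro i j
      by_contra! hlt
      have hij : i ≠ j := by rintro rfl; omega
      have hs := sum_swap x i j hij (fun t => (t : ℝ))
      have hg := sum_swap x i j hij (fun t => (t : ℝ) ^ α)
      have h1 := H (fun k => if k = i then x i - 1 else if k = j then x j + 1 else x k)
        (by intro k; have := hx k; split_ifs <;> omega)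
        (by
          rw [← hsum]
          have : ((x i - 1 : ℕ) : ℝ) = x i - 1 := by
            rw [Nat.cast_sub (hx i)]; simp
          simp only [this] at hs
          rw [← Nat.cast_inj (R := ℝ), Nat.cast_sum, Nat.cast_sum, hs]
          push_cast; ring)
      have h2 := hd (show x j < x i - 1 by omega)
      simp only [Nat.sub_add_cancel (hx i)] at h2
      linarith
    intro i j
    have := key i j
    have := key j i
    rw [abs_le]; omega
  · intro H y hy hys
    have : Nonempty (Fin n) := ⟨⟨0, hn⟩⟩
    obtain ⟨i₀, h0⟩ := Finite.exists_min x
    set m := x i₀ with hm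
    set D : ℝ := ((m + 1 : ℕ) : ℝ) ^ α - (m : ℝ) ^ α with hD
    have hxe : ∀ i, (x i : ℝ) ^ α = (m : ℝ) ^ α + ((x i : ℝ) - m) * D := by
      intro i
      have a := h0 i
      have b := H i i₀
      rw [abs_le] at b
      have : x i = m ∨ x i = m + 1 := by omega
      rcases this with h | h
      · rw [h]; ring
      · rw [h, hD]; push_cast; ring
    have hS : ∑ i, (y i : ℝ) = ∑ i, (x i : ℝ) := by
      rw [← Nat.cast_sum, ← Nat.cast_sum, hys, hsum]
    calc ∑ i, (y i : ℝ) ^ α ≤ ∑ i, ((m : ℝ) ^ α + ((y i : ℝ) - m) * D) :=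
          Finset.sum_le_sum fun i _ => secant (fun t => (t : ℝ) ^ α) hd m (y i)
      _ = ∑ i, ((m : ℝ) ^ α + ((x i : ℝ) - m) * D) := by
          simp only [Finset.sum_add_distrib, ← Finset.sum_mul, Finset.sum_sub_distrib, hS]
      _ = ∑ i, (x i : ℝ) ^ α := Finset.sum_congr rfl fun i _ => (hxe i).symm
end
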